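/- arXiv:1003.6073 — 3 statements merged into one kernel-verified Lean document; each statement's English description precedes it below -/
import Mathlib

section
/- Let B be a reduced commutative ℂ-algebra of finite type, let I be a finitely generated projective B-module, and let 0 → I →^j O′ →^π B → 0 be a square-zero extension of ℂ-algebras: O′ is a commutative ℂ-algebra, π is a surjective ring homomorphism, and the kernel j(I) satisfies j(I)² = 0 (so that j(I) is a B-module, identified with I). Then the conormal sequence I → Ω_{O′/ℂ} ⊗_{O′} B → Ω_{B/ℂ} → 0 is exact and, moreover, exact on the left: the map I → Ω_{O′/ℂ} ⊗_{O′} B sending y to dj(y) ⊗ 1 is injective. -/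
open TensorProduct

noncomputable section

/-- The localization of a reduced finite type algebra over a perfect field at a minimal prime
is formally smooth. -/
theorem formallySmooth_localization_minimalPrime {k B : Type*} [Field k] [PerfectField k]
    [CommRing B] [Algebra k B] [IsReduced B] [Algebra.FiniteType k B] (p : Ideal B) [p.IsPrime]
    (hp : p ∈ minimalPrimes B) : Algebra.FormallySmooth k (Localization.AtPrime p) := by
  have h₁ : Subsingleton (PrimeSpectrum (Localization.AtPrime p)) :=
    IsLocalization.subsingleton_primeSpectrum_of_mem_minimalPrimes p hp _
  have h₂ : IsField (Localization.AtPrime p) :=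
    (PrimeSpectrum.subsingleton_iff_isField_of_isReduced).mp h₁
  have h₃ : Algebra.EssFiniteType B (Localization.AtPrime p) :=
    .of_isLocalization _ p.primeCompl
  have h₄ : Algebra.EssFiniteType k (Localization.AtPrime p) := .comp k B _
  let _ := h₂.toField
  exact Algebra.FormallySmooth.of_perfectField

/-- If `s : B → Q` splits `A → B` up to a square-zero ideal of an `A`-algebra `Q`, then an element
of `A` dying in `B` whose differential dies in `B ⊗ Ω` also dies in `Q`. -/
theorem algebraMap_eq_zero_of_one_tmul_D_eq_zero {R A B Q : Type*} [CommRing R]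
    [CommRing A] [CommRing B] [CommRing Q] [Algebra R A] [Algebra R B] [Algebra R Q]
    [Algebra A B] [IsScalarTower R A B] [Algebra A Q] [IsScalarTower R A Q]
    (J : Ideal Q) (hJ : ∀ x ∈ J, ∀ y ∈ J, x * y = 0) (s : B →ₐ[R] Q)
    (hs : ∀ a : A, algebraMap A Q a - s (algebraMap A B a) ∈ J)
    (x : A) (hx : algebraMap A B x = 0)
    (hdx : (1 : B) ⊗ₜ[A] KaehlerDifferential.D R A x = 0) : algebraMap A Q x = 0 := by
  let δ : Derivation R A J := Derivation.mk'
    (LinearMap.codRestrict (J.restrictScalars R)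
      ((IsScalarTower.toAlgHom R A Q).toLinearMap -
        s.toLinearMap ∘ₗ (IsScalarTower.toAlgHom R A B).toLinearMap) hs) (by
      intro a b
      apply Subtype.ext
      have h := hJ _ (hs a) _ (hs b)
      change algebraMap A Q (a * b) - s (algebraMap A B (a * b)) =
        a • (algebraMap A Q b - s (algebraMap A B b)) +
        b • (algebraMap A Q a - s (algebraMap A B a))
      simp only [Algebra.smul_def, map_mul]
      linear_combination -h)
  have hδ (a : A) : (δ a : Q) = algebraMap A Q a - s (algebraMap A B a) := rfl
  let Φ : B →ₗ[A] Ω[A⁄R] →ₗ[A] Q := LinearMap.mk₂ A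
    (fun b ω => s b * (δ.liftKaehlerDifferential ω : Q))
    (fun _ _ _ => by rw [map_add, add_mul])
    (fun a b ω => by
      have h := hJ _ (hs a) _ (δ.liftKaehlerDifferential ω).2
      simp only [Algebra.smul_def, map_mul]
      linear_combination -(s b) * h)
    (fun _ _ _ => by rw [map_add, Submodule.coe_add, mul_add])
    (fun a b ω => by
      rw [map_smul, Submodule.coe_smul_of_tower, mul_smul_comm])
  have h : TensorProduct.lift Φ ((1 : B) ⊗ₜ[A] KaehlerDifferential.D R A x) = 0 := by
    rw [hdx, map_zero]
  simpa [Φ, hδ, hx] using h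

/-- For a square-zero extension `A → B`, an element of the kernel whose differential dies in
`B ⊗ Ω` is killed by an element outside `p`, provided `B` localized at `p` is formally smooth. -/
theorem exists_notMem_mul_eq_zero_of_one_tmul_D_eq_zero {R A B : Type*} [CommRing R]
    [CommRing A] [CommRing B] [Algebra R A] [Algebra R B] [Algebra A B] [IsScalarTower R A B]
    (hsurj : Function.Surjective (algebraMap A B))
    (hsq : ∀ x y : A, algebraMap A B x = 0 → algebraMap A B y = 0 → x * y = 0)
    (p : Ideal B) [p.IsPrime] [Algebra.FormallySmooth R (Localization.AtPrime p)]
    (x : A) (hx : algebraMap A B x = 0)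
    (hdx : (1 : B) ⊗ₜ[A] KaehlerDifferential.D R A x = 0) :
    ∃ t : A, algebraMap A B t ∉ p ∧ t * x = 0 := by
  let M : Submonoid A := p.primeCompl.comap (algebraMap A B)
  have hM : M.map (algebraMap A B) = p.primeCompl :=
    Submonoid.map_comap_eq_of_surjective hsurj _
  let K := Localization.AtPrime p
  let Q := Localization M
  let φ : Q →+* K := IsLocalization.map K (algebraMap A B) (hM.symm ▸ M.le_comap_map)
  have hφ (a : A) : φ (algebraMap A Q a) = algebraMap B K (algebraMap A B a) :=
    IsLocalization.map_eq _ a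
  have hker : RingHom.ker φ = (RingHom.ker (algebraMap A B)).map (algebraMap A Q) :=
    IsLocalization.ker_map K (algebraMap A B) hM
  let g : Q →ₐ[R] K :=
    { φ with
      commutes' := fun r => by
        change φ (algebraMap R Q r) = _
        rw [IsScalarTower.algebraMap_apply R A Q, hφ, ← IsScalarTower.algebraMap_apply R A B,
          ← IsScalarTower.algebraMap_apply R B K] }
  have hg : Function.Surjective g := by
    intro z
    obtain ⟨b, t, rfl⟩ := IsLocalization.exists_mk'_eq p.primeCompl z
    obtain ⟨a, rfl⟩ := hsurj b
    obtain ⟨u, hu⟩ := hsurj t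
    have huM : u ∈ M := by
      change algebraMap A B u ∈ p.primeCompl
      rw [hu]
      exact t.2
    refine ⟨IsLocalization.mk' Q a ⟨u, huM⟩, ?_⟩
    refine (IsLocalization.map_mk' (T := p.primeCompl) (hM.symm ▸ M.le_comap_map) a (⟨u, huM⟩ : M)).trans ?_
    congr 1
    exact Subtype.ext hu
  have hsq' : RingHom.ker φ ^ 2 = ⊥ := by
    rw [hker, ← Ideal.map_pow, pow_two, ← le_bot_iff, Ideal.map_le_iff_le_comap, Ideal.mul_le]
    intro a ha b hb
    rw [hsq a b ha hb]
    exact zero_mem _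
  let s₀ : K →ₐ[R] Q :=
    Algebra.FormallySmooth.liftOfSurjective (AlgHom.id R K) g hg ⟨2, hsq'⟩
  have hs₀ (z : K) : φ (s₀ z) = z :=
    Algebra.FormallySmooth.liftOfSurjective_apply (AlgHom.id R K) g hg ⟨2, hsq'⟩ z
  have hzero : algebraMap A Q x = 0 := by
    refine algebraMap_eq_zero_of_one_tmul_D_eq_zero (R := R) (B := B) (RingHom.ker φ) ?_
      (s₀.comp (IsScalarTower.toAlgHom R B K)) ?_ x hx hdx
    · intro a ha b hb
      rw [← Ideal.mem_bot, ← hsq', pow_two]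
      exact Ideal.mul_mem_mul ha hb
    · intro a
      rw [RingHom.mem_ker, map_sub, hφ, AlgHom.comp_apply, hs₀]
      exact sub_self _
  obtain ⟨t, ht⟩ := (IsLocalization.map_eq_zero_iff M Q x).mp hzero
  exact ⟨t, t.2, ht⟩

/-- let `B` be a reduced commutative `ℂ`-algebra of finite type, `I` a
finitely generated projective `B`-module, and `0 → I →ʲ O′ →^π B → 0` a square-zero
extension of `ℂ`-algebras.  Then the conormal sequence
`I → Ω_{O′/ℂ} ⊗_{O′} B → Ω_{B/ℂ} → 0` is exact and, moreover, exact on the left: the map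
`I → Ω_{O′/ℂ} ⊗_{O′} B`, `y ↦ d(j(y)) ⊗ 1`, is injective. -/
theorem stmt8 (B I O' : Type*) [CommRing B] [Algebra ℂ B] [IsReduced B]
    [Algebra.FiniteType ℂ B]
    [AddCommGroup I] [Module B I] [Module.Finite B I] [Module.Projective B I]
    [CommRing O'] [Algebra ℂ O']
    -- the square-zero extension `0 → I →ʲ O′ →^π B → 0`
    (π : O' →ₐ[ℂ] B) (j : I →+ O')
    (hπ : Function.Surjective π) (hj : Function.Injective j)
    (hker : ∀ o : O', π o = 0 ↔ o ∈ Set.range j)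
    (hsq : ∀ y z : I, j y * j z = 0)
    (hsmul : ∀ (o : O') (y : I), o * j y = j (π o • y)) :
    -- form `Ω_{O′/ℂ} ⊗_{O′} B` with `B` an `O′`-algebra via `π`
    letI : Algebra O' B := π.toRingHom.toAlgebra
    ∃ (f : I →ₗ[B] B ⊗[O'] Ω[O'⁄ℂ]) (g : B ⊗[O'] Ω[O'⁄ℂ] →ₗ[B] Ω[B⁄ℂ]),
      -- `f` sends `y` to `d(j(y)) ⊗ 1`
      (∀ y : I, f y = (1 : B) ⊗ₜ[O'] KaehlerDifferential.D ℂ O' (j y)) ∧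
      -- `g` is induced by the universal derivation, i.e. `b ⊗ d(o) ↦ b·d(π(o))`
      (∀ (b : B) (o : O'), g (b ⊗ₜ[O'] KaehlerDifferential.D ℂ O' o) =
        b • KaehlerDifferential.D ℂ B (π o)) ∧
      -- the conormal sequence is exact and surjective on the right
      Function.Surjective g ∧ Function.Exact f g ∧
      -- moreover it is exact on the left
      Function.Injective f := by
  let _ : Algebra O' B := π.toRingHom.toAlgebra
  have halg (o : O') : algebraMap O' B o = π o := rfl
  have : IsScalarTower ℂ O' B := IsScalarTower.of_algebraMap_eq fun r => (π.commutes r).symm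
  have hπj (y : I) : π (j y) = 0 := (hker _).mpr ⟨y, rfl⟩
  let f : I →ₗ[B] B ⊗[O'] Ω[O'⁄ℂ] :=
    { toFun := fun y => (1 : B) ⊗ₜ[O'] KaehlerDifferential.D ℂ O' (j y)
      map_add' := fun y z => by rw [map_add, map_add, TensorProduct.tmul_add]
      map_smul' := fun b y => by
        obtain ⟨o, rfl⟩ := hπ b
        rw [← hsmul, Derivation.leibniz, TensorProduct.tmul_add, TensorProduct.tmul_smul,
          TensorProduct.tmul_smul, TensorProduct.smul_tmul', TensorProduct.smul_tmul',
          Algebra.smul_def (j y), halg, hπj, zero_mul, TensorProduct.zero_tmul, add_zero,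
          RingHom.id_apply, TensorProduct.smul_tmul', Algebra.smul_def, halg, smul_eq_mul] }
  have hf (y : I) : f y = (1 : B) ⊗ₜ[O'] KaehlerDifferential.D ℂ O' (j y) := rfl
  refine ⟨f, KaehlerDifferential.mapBaseChange ℂ O' B, hf, fun b o => ?_,
    KaehlerDifferential.mapBaseChange_surjective ℂ O' B hπ, ?_, ?_⟩
  · rw [KaehlerDifferential.mapBaseChange_tmul, KaehlerDifferential.map_D, halg]
  · intro ω
    rw [KaehlerDifferential.exact_kerCotangentToTensor_mapBaseChange ℂ O' B hπ ω]
    constructor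
    · rintro ⟨c, rfl⟩
      obtain ⟨⟨x, hx⟩, rfl⟩ := Ideal.toCotangent_surjective _ c
      obtain ⟨y, rfl⟩ := (hker x).mp hx
      exact ⟨y, rfl⟩
    · rintro ⟨y, rfl⟩
      exact ⟨Ideal.toCotangent _ ⟨j y, hπj y⟩, rfl⟩
  · rw [injective_iff_map_eq_zero]
    intro y hy
    rw [← Module.forall_dual_apply_eq_zero_iff B]
    intro ψ
    suffices h : ψ y ∈ nilradical B by rwa [nilradical_eq_zero] at h
    rw [nilradical, ← Ideal.sInf_minimalPrimes, Ideal.mem_sInf]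
    intro p hp
    have : p.IsPrime := hp.1.1
    have := formallySmooth_localization_minimalPrime (k := ℂ) p hp
    obtain ⟨t, htp, ht⟩ := exists_notMem_mul_eq_zero_of_one_tmul_D_eq_zero (R := ℂ) hπ
      (fun a b ha hb => by
        obtain ⟨y, rfl⟩ := (hker a).mp ha
        obtain ⟨z, rfl⟩ := (hker b).mp hb
        exact hsq y z) p (j y) (hπj y) hy
    have hty : π t • y = 0 := hj (by rw [← hsmul, ht, map_zero])
    have hmem : π t * ψ y ∈ p := by
      rw [← smul_eq_mul, ← map_smul, hty, map_zero]
      exact zero_mem p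
    exact (Ideal.IsPrime.mem_or_mem ‹p.IsPrime› hmem).resolve_left htp
end
end

section
/- Let B be a reduced commutative ℂ-algebra of finite type and let I be a finitely generated projective B-module. Then the map which assigns to (the isomorphism class of) a square-zero extension 0 → I → O′ → B → 0 of ℂ-algebras the class of its conormal sequence 0 → I → Ω_{O′/ℂ} ⊗_{O′} B → Ω_{B/ℂ} → 0 in Ext¹_B(Ω_{B/ℂ}, I) is a bijection between the set of isomorphism classes of square-zero extensions of B by I and Ext¹_B(Ω_{B/ℂ}, I). -/
open TensorProduct

noncomputable section

universe u

/-- A square-zero extension `0 → I → O′ → B → 0` of the `ℂ`-algebra `B` by the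
`B`-module `I`. -/
structure SqZeroExtension (B : Type u) [CommRing B] [Algebra ℂ B]
    (I : Type u) [AddCommGroup I] [Module B I] : Type (u + 1) where
  O : Type u
  [ringO : CommRing O]
  [algO : Algebra ℂ O]
  π : O →ₐ[ℂ] B
  j : I →+ O
  πsurj : Function.Surjective π
  jinj : Function.Injective j
  ker_eq : ∀ o : O, π o = 0 ↔ o ∈ Set.range j
  sq_zero : ∀ y z : I, j y * j z = 0
  smul_compat : ∀ (o : O) (y : I), o * j y = j (π o • y)

attribute [instance] SqZeroExtension.ringO SqZeroExtension.algO

/-- Isomorphism of square-zero extensions: a `ℂ`-algebra isomorphism commuting with the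
maps to `B` and from `I`. -/
def SqZeroExtension.Iso {B : Type u} [CommRing B] [Algebra ℂ B]
    {I : Type u} [AddCommGroup I] [Module B I]
    (X₁ X₂ : SqZeroExtension B I) : Prop :=
  ∃ φ : X₁.O ≃ₐ[ℂ] X₂.O,
    (∀ o : X₁.O, X₂.π (φ o) = X₁.π o) ∧ (∀ y : I, φ (X₁.j y) = X₂.j y)

/-- An extension `0 → G → E → F → 0` of `B`-modules. -/
structure ModuleExtension (B F G : Type u) [CommRing B]
    [AddCommGroup F] [Module B F] [AddCommGroup G] [Module B G] : Type (u + 1) where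
  E : Type u
  [addE : AddCommGroup E]
  [modE : Module B E]
  ι : G →ₗ[B] E
  p : E →ₗ[B] F
  ιinj : Function.Injective ι
  psurj : Function.Surjective p
  exact : Function.Exact ι p

attribute [instance] ModuleExtension.addE ModuleExtension.modE

/-- Equivalence of module extensions: a `B`-linear isomorphism of the middle terms
commuting with the structure maps. -/
def ModuleExtension.Iso {B F G : Type u} [CommRing B]
    [AddCommGroup F] [Module B F] [AddCommGroup G] [Module B G]
    (e₁ e₂ : ModuleExtension B F G) : Prop :=
  ∃ φ : e₁.E ≃ₗ[B] e₂.E,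
    (∀ y : G, φ (e₁.ι y) = e₂.ι y) ∧ (∀ x : e₁.E, e₂.p (φ x) = e₁.p x)

/-- `ext` is (a representative of) the conormal sequence
`0 → I → Ω_{O′/ℂ} ⊗_{O′} B → Ω_{B/ℂ} → 0` of the square-zero extension `X`. -/
def IsConormalSequence {B : Type u} [CommRing B] [Algebra ℂ B]
    {I : Type u} [AddCommGroup I] [Module B I]
    (X : SqZeroExtension B I) (ext : ModuleExtension B (Ω[B⁄ℂ]) I) : Prop :=
  letI : Algebra X.O B := X.π.toRingHom.toAlgebra
  ∃ e : ext.E ≃ₗ[B] (B ⊗[X.O] Ω[X.O⁄ℂ]),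
    (∀ y : I, e (ext.ι y) = (1 : B) ⊗ₜ[X.O] KaehlerDifferential.D ℂ X.O (X.j y)) ∧
    (∀ (b : B) (o : X.O), ext.p (e.symm (b ⊗ₜ[X.O] KaehlerDifferential.D ℂ X.O o)) =
      b • KaehlerDifferential.D ℂ B (X.π o))

theorem exists_section_localization {O B : Type u} [CommRing O] [CommRing B] [Algebra ℂ O]
    [Algebra ℂ B] [IsReduced B] [Algebra.FiniteType ℂ B] (π : O →ₐ[ℂ] B)
    (hπ : Function.Surjective π) (hsq : ∀ x y, π x = 0 → π y = 0 → x * y = 0)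
    (p : Ideal B) (hp : p ∈ minimalPrimes B) :
    ∃ (A : Type u) (_ : CommRing A) (_ : Algebra ℂ A) (i : O →ₐ[ℂ] A) (s : B →ₐ[ℂ] A),
      (∀ x y, (i x - s (π x)) * (i y - s (π y)) = 0) ∧
      ∀ x, i x = 0 → ∃ t, π t ∉ p ∧ t * x = 0 := by
  have hpp : p.IsPrime := hp.isPrime
  let K := Localization.AtPrime p
  have : Ring.KrullDimLE 0 K := Ring.KrullDimLE.of_isLocalization p hp K
  have : IsReduced K := inferInstance
  let : Field K := (Ring.KrullDimLE.isField_of_isReduced (R := K)).toField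
  have : Algebra.EssFiniteType ℂ K := Algebra.EssFiniteType.comp ℂ B K
  have : Algebra.FormallySmooth ℂ K := inferInstance
  let M : Submonoid O := p.primeCompl.comap π
  let A := Localization M
  let f : O →ₐ[ℂ] K := (IsScalarTower.toAlgHom ℂ B K).comp π
  let g : A →ₐ[ℂ] K := IsLocalization.liftAlgHom (M := M) (f := f)
    fun y => IsLocalization.map_units (M := p.primeCompl) K ⟨π y, y.2⟩
  have hg : ∀ o, g (algebraMap O A o) = algebraMap B K (π o) := fun o => by
    exact IsLocalization.lift_eq _ o
  have hgs : Function.Surjective g := by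
    intro k
    obtain ⟨b, s, rfl⟩ := IsLocalization.exists_mk'_eq p.primeCompl k
    obtain ⟨b, rfl⟩ := hπ b
    obtain ⟨t, ht⟩ := hπ s
    let t' : M := ⟨t, by rw [Submonoid.mem_comap, ht]; exact s.2⟩
    refine ⟨IsLocalization.mk' A b t', ?_⟩
    rw [IsLocalization.eq_mk'_iff_mul_eq, ← ht, ← hg, ← hg, ← map_mul]
    exact congrArg g (IsLocalization.mk'_spec A b t')
  have hker : ∀ a, g a = 0 → ∃ u o, IsUnit u ∧ π o = 0 ∧ a * u = algebraMap O A o := by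
    intro a ha
    obtain ⟨o, s, rfl⟩ := IsLocalization.exists_mk'_eq M a
    have h1 : algebraMap B K (π o) = 0 := by
      rw [← hg, ← IsLocalization.mk'_spec A o s, map_mul, ha, zero_mul]
    obtain ⟨t, ht⟩ := (IsLocalization.map_eq_zero_iff p.primeCompl K _).1 h1
    obtain ⟨t, htm⟩ := t
    obtain ⟨t, rfl⟩ := hπ t
    refine ⟨algebraMap O A (s * t), t * o, ?_, by simpa using ht, ?_⟩
    · exact IsLocalization.map_units A (s * ⟨t, htm⟩ : M)
    · rw [map_mul, ← mul_assoc, IsLocalization.mk'_spec, ← map_mul, mul_comm]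
  have hker2 : ∀ a b, g a = 0 → g b = 0 → a * b = 0 := by
    intro a b ha hb
    obtain ⟨u, o, hu, ho, h1⟩ := hker a ha
    obtain ⟨v, o', hv, ho', h2⟩ := hker b hb
    rw [← (hu.mul hv).mul_left_eq_zero, mul_mul_mul_comm, h1, h2, ← map_mul, hsq _ _ ho ho',
      map_zero]
  have hnil : IsNilpotent (RingHom.ker (g : A →+* K)) := by
    refine ⟨2, ?_⟩
    rw [pow_two, Ideal.zero_eq_bot, eq_bot_iff, Ideal.mul_le]
    exact fun a ha b hb => by simpa using hker2 a b ha hb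
  let σ : K →ₐ[ℂ] A := Algebra.FormallySmooth.liftOfSurjective (AlgHom.id ℂ K) g hgs hnil
  have hσ : ∀ k, g (σ k) = k := fun k =>
    Algebra.FormallySmooth.liftOfSurjective_apply (AlgHom.id ℂ K) g hgs hnil k
  refine ⟨A, inferInstance, inferInstance, IsScalarTower.toAlgHom ℂ O A,
    σ.comp (IsScalarTower.toAlgHom ℂ B K), fun x y => hker2 _ _ ?_ ?_, fun x hx => ?_⟩
  · simp [hσ, hg]
  · simp [hσ, hg]
  · obtain ⟨t, ht⟩ := (IsLocalization.map_eq_zero_iff M A _).1 hx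
    exact ⟨t, t.2, ht⟩

theorem exists_mul_eq_zero_of_one_tmul_D_eq_zero {O B : Type u} [CommRing O] [CommRing B]
    [Algebra ℂ O] [Algebra ℂ B] [Algebra O B] [IsScalarTower ℂ O B] [IsReduced B]
    [Algebra.FiniteType ℂ B] (hπ : Function.Surjective (algebraMap O B))
    (hsq : ∀ x y, algebraMap O B x = 0 → algebraMap O B y = 0 → x * y = 0)
    (p : Ideal B) (hp : p ∈ minimalPrimes B) (x : O) (hx : algebraMap O B x = 0)
    (hD : (1 : B) ⊗ₜ[O] KaehlerDifferential.D ℂ O x = 0) :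
    ∃ t, algebraMap O B t ∉ p ∧ t * x = 0 := by
  obtain ⟨A, _, _, i, s, h1, h2⟩ :=
    exists_section_localization (IsScalarTower.toAlgHom ℂ O B) hπ hsq p hp
  refine h2 x ?_
  let : Module B A := Module.compHom A s.toRingHom
  let : Module O A := Module.compHom A (s.toRingHom.comp (algebraMap O B))
  have hB : ∀ (b : B) (a : A), b • a = s b * a := fun _ _ => rfl
  have hO : ∀ (o : O) (a : A), o • a = s (algebraMap O B o) * a := fun _ _ => rfl
  have : IsScalarTower O B A := ⟨fun o b a => by
    rw [hB, hO, hB, Algebra.smul_def, map_mul, mul_assoc]⟩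
  have : IsScalarTower ℂ O A := ⟨fun c o a => by
    rw [hO, hO, Algebra.smul_def, map_mul, map_mul, mul_assoc,
      ← IsScalarTower.algebraMap_apply ℂ O B, AlgHom.commutes, Algebra.smul_def]⟩
  let δ : Derivation ℂ O A := Derivation.mk'
    (i.toLinearMap - s.toLinearMap ∘ₗ (IsScalarTower.toAlgHom ℂ O B).toLinearMap) fun a b => by
      have := h1 a b
      simp only [hO, LinearMap.sub_apply, LinearMap.comp_apply, AlgHom.toLinearMap_apply, map_mul,
        IsScalarTower.coe_toAlgHom'] at this ⊢
      linear_combination this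
  have := congrArg (δ.liftKaehlerDifferential.liftBaseChange B) hD
  simpa [δ, hx] using this

theorem one_tmul_D_injective {O B I : Type u} [CommRing O] [CommRing B]
    [Algebra ℂ O] [Algebra ℂ B] [Algebra O B] [IsScalarTower ℂ O B] [IsReduced B]
    [Algebra.FiniteType ℂ B] [AddCommGroup I] [Module B I] [Module.Projective B I]
    (hπ : Function.Surjective (algebraMap O B))
    (hsq : ∀ x y, algebraMap O B x = 0 → algebraMap O B y = 0 → x * y = 0)
    (j : I →+ O) (hj : Function.Injective j) (hjπ : ∀ y, algebraMap O B (j y) = 0)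
    (hsmul : ∀ (o : O) (y : I), o * j y = j (algebraMap O B o • y)) (y : I)
    (hD : (1 : B) ⊗ₜ[O] KaehlerDifferential.D ℂ O (j y) = 0) : y = 0 := by
  rw [← Module.forall_dual_apply_eq_zero_iff B]
  intro φ
  have : φ y ∈ sInf (minimalPrimes B) := by
    rw [Ideal.mem_sInf]
    intro p hp
    have hpp : p.IsPrime := hp.isPrime
    obtain ⟨t, ht, h⟩ :=
      exists_mul_eq_zero_of_one_tmul_D_eq_zero hπ hsq p hp (j y) (hjπ y) hD
    rw [hsmul, map_eq_zero_iff j hj] at h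
    refine (hpp.mem_or_mem (x := algebraMap O B t) ?_).resolve_left ht
    rw [← smul_eq_mul, ← map_smul, h, map_zero]
    exact p.zero_mem
  rw [minimalPrimes, Ideal.sInf_minimalPrimes, ← Ideal.zero_eq_bot, ← nilradical,
    nilradical_eq_zero] at this
  simpa using this

theorem ModuleExtension.Iso.equivalence {B F G : Type u} [CommRing B]
    [AddCommGroup F] [Module B F] [AddCommGroup G] [Module B G] :
    Equivalence (ModuleExtension.Iso (B := B) (F := F) (G := G)) where
  refl e := ⟨LinearEquiv.refl B e.E, fun _ => rfl, fun _ => rfl⟩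
  symm := by
    rintro e₁ e₂ ⟨φ, hι, hp⟩
    exact ⟨φ.symm, fun y => by rw [← hι, φ.symm_apply_apply],
      fun x => by rw [← hp, φ.apply_symm_apply]⟩
  trans := by
    rintro e₁ e₂ e₃ ⟨φ, hι, hp⟩ ⟨ψ, hι', hp'⟩
    exact ⟨φ.trans ψ, fun y => by rw [LinearEquiv.trans_apply, hι, hι'],
      fun x => by rw [LinearEquiv.trans_apply, hp', hp]⟩

theorem ModuleExtension.iso_of_hom {B F G : Type u} [CommRing B]
    [AddCommGroup F] [Module B F] [AddCommGroup G] [Module B G]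
    {e₁ e₂ : ModuleExtension B F G} (φ : e₁.E →ₗ[B] e₂.E)
    (hι : ∀ y, φ (e₁.ι y) = e₂.ι y) (hp : ∀ x, e₂.p (φ x) = e₁.p x) : e₁.Iso e₂ := by
  refine ⟨LinearEquiv.ofBijective φ ⟨?_, fun z => ?_⟩, hι, hp⟩
  · rw [injective_iff_map_eq_zero]
    intro x hx
    obtain ⟨y, rfl⟩ := (e₁.exact x).1 (by rw [← hp, hx, map_zero])
    rw [hι, map_eq_zero_iff _ e₂.ιinj] at hx
    rw [hx, map_zero]
  · obtain ⟨x, hx⟩ := e₁.psurj (e₂.p z)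
    obtain ⟨y, hy⟩ := (e₂.exact (z - φ x)).1 (by rw [map_sub, hp, hx, sub_self])
    exact ⟨x + e₁.ι y, by rw [map_add, hι, hy, add_sub_cancel]⟩

namespace SqZeroExtension

variable {B I : Type u} [CommRing B] [Algebra ℂ B] [AddCommGroup I] [Module B I]

theorem π_j (X : SqZeroExtension B I) (y : I) : X.π (X.j y) = 0 :=
  (X.ker_eq _).2 ⟨y, rfl⟩

/-- A derivation of `X.O` into the middle term of `e` lying over the universal derivation of `B`
and restricting to the inclusion of `I`. Its existence identifies `X` with the pullback of `e`
along the universal derivation. -/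
def Compatible (X : SqZeroExtension B I) (e : ModuleExtension B (Ω[B⁄ℂ]) I) : Prop :=
  ∃ δ : X.O →+ e.E, (∀ c : ℂ, δ (algebraMap ℂ X.O c) = 0) ∧
    (∀ a b, δ (a * b) = X.π a • δ b + X.π b • δ a) ∧ (∀ y, δ (X.j y) = e.ι y) ∧
    ∀ o, e.p (δ o) = KaehlerDifferential.D ℂ B (X.π o)

theorem Compatible.of_iso_left {X X' : SqZeroExtension B I}
    {e : ModuleExtension B (Ω[B⁄ℂ]) I} (h : X'.Compatible e) (hX : X.Iso X') :
    X.Compatible e := by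
  obtain ⟨δ, h1, h2, h3, h4⟩ := h
  obtain ⟨φ, hπ, hj⟩ := hX
  refine ⟨δ.comp (φ : X.O →+ X'.O), fun c => ?_, fun a b => ?_, fun y => ?_, fun o => ?_⟩
  · simp [h1]
  · simp [h2, hπ]
  · simp [hj, h3]
  · simp [h4, hπ]

theorem Compatible.of_iso_right {X : SqZeroExtension B I}
    {e e' : ModuleExtension B (Ω[B⁄ℂ]) I} (h : X.Compatible e) (he : e.Iso e') :
    X.Compatible e' := by
  obtain ⟨δ, h1, h2, h3, h4⟩ := h
  obtain ⟨φ, hι, hp⟩ := he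
  refine ⟨(φ : e.E →+ e'.E).comp δ, fun c => ?_, fun a b => ?_, fun y => ?_, fun o => ?_⟩
  · simp [h1]
  · simp [h2]
  · simp [hι, h3]
  · simp [h4, hp]

theorem Compatible.iso {X X' : SqZeroExtension B I} {e : ModuleExtension B (Ω[B⁄ℂ]) I}
    (h : X.Compatible e) (h' : X'.Compatible e) : X.Iso X' := by
  have inj : ∀ {X : SqZeroExtension B I} (δ : X.O →+ e.E), (∀ y, δ (X.j y) = e.ι y) →
      ∀ a b, X.π a = X.π b → δ a = δ b → a = b := by
    intro X δ hj a b hπ hδ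
    obtain ⟨y, hy⟩ := (X.ker_eq (a - b)).1 (by rw [map_sub, hπ, sub_self])
    have h0 : e.ι y = 0 := by rw [← hj, hy, map_sub, hδ, sub_self]
    rw [map_eq_zero_iff _ e.ιinj] at h0
    rw [← sub_eq_zero, ← hy, h0, map_zero]
  have surj : ∀ {X : SqZeroExtension B I} (δ : X.O →+ e.E), (∀ y, δ (X.j y) = e.ι y) →
      (∀ o, e.p (δ o) = KaehlerDifferential.D ℂ B (X.π o)) →
      ∀ b x, e.p x = KaehlerDifferential.D ℂ B b → ∃ o, X.π o = b ∧ δ o = x := by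
    intro X δ hj hp b x hx
    obtain ⟨o, rfl⟩ := X.πsurj b
    obtain ⟨y, hy⟩ := (e.exact (x - δ o)).1 (by rw [map_sub, hx, hp, sub_self])
    exact ⟨o + X.j y, by rw [map_add, π_j, add_zero], by rw [map_add, hj, hy, add_sub_cancel]⟩
  obtain ⟨δ, h1, h2, h3, h4⟩ := h
  obtain ⟨δ', h1', h2', h3', h4'⟩ := h'
  choose φ hφ hφ' using fun o => surj δ' h3' h4' (X.π o) (δ o) (h4 o)
  let Φ : X.O →ₐ[ℂ] X'.O :=
    AlgHom.mk' { toFun := φ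
                 map_one' := inj δ' h3' _ _ (by simp [hφ]) (by
                   rw [hφ', ← map_one (algebraMap ℂ X.O), ← map_one (algebraMap ℂ X'.O), h1, h1'])
                 map_mul' := fun a b => inj δ' h3' _ _ (by simp [hφ])
                   (by simp [hφ, hφ', h2, h2'])
                 map_zero' := inj δ' h3' _ _ (by simp [hφ]) (by simp [hφ'])
                 map_add' := fun a b => inj δ' h3' _ _ (by simp [hφ]) (by simp [hφ']) }
      fun c a => inj δ' h3' _ _ (by simp [hφ])
        (by simp [Algebra.smul_def, hφ, hφ', h1, h1', h2, h2'])
  refine ⟨AlgEquiv.ofBijective Φ ⟨fun a b hab => ?_, fun o => ?_⟩, hφ, fun y => ?_⟩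
  · replace hab : φ a = φ b := hab
    exact inj δ h3 _ _ (by rw [← hφ, hab, hφ]) (by rw [← hφ', hab, hφ'])
  · obtain ⟨a, ha, ha'⟩ := surj δ h3 h4 (X'.π o) (δ' o) (h4' o)
    exact ⟨a, inj δ' h3' _ _ ((hφ a).trans ha) ((hφ' a).trans ha')⟩
  · exact inj δ' h3' _ _ ((hφ _).trans (by rw [π_j, π_j])) ((hφ' _).trans (by rw [h3, h3']))

theorem exists_compatible (e : ModuleExtension B (Ω[B⁄ℂ]) I) :
    ∃ X : SqZeroExtension B I, X.Compatible e := by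
  let : Module Bᵐᵒᵖ e.E := Module.compHom e.E ((RingHom.id B).fromOpposite mul_comm)
  have : IsCentralScalar B e.E := ⟨fun _ _ => rfl⟩
  let : Module ℂ e.E := Module.compHom e.E (algebraMap ℂ B)
  have : IsScalarTower ℂ B e.E := IsScalarTower.of_algebraMap_smul fun _ _ => rfl
  have : IsScalarTower ℂ Bᵐᵒᵖ e.E := ⟨fun c b x => by
    obtain ⟨b, rfl⟩ := MulOpposite.op_surjective b
    rw [← MulOpposite.op_smul, op_smul_eq_smul, op_smul_eq_smul, smul_assoc]⟩
  let P : Subalgebra ℂ (TrivSqZeroExt B e.E) :=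
    { carrier := {x | e.p x.snd = KaehlerDifferential.D ℂ B x.fst}
      mul_mem' := fun {a b} ha hb => by
        simp only [Set.mem_ofPred_eq] at ha hb ⊢
        simp [ha, hb]
      add_mem' := fun {a b} ha hb => by
        simp only [Set.mem_ofPred_eq] at ha hb ⊢
        simp [ha, hb]
      algebraMap_mem' := fun c => by
        simp [TrivSqZeroExt.algebraMap_eq_inl'] }
  let X : SqZeroExtension B I :=
    { O := P
      π := (TrivSqZeroExt.fstHom ℂ B e.E).comp P.val
      j := { toFun := fun y => ⟨TrivSqZeroExt.inr (e.ι y), by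
               change e.p (e.ι y) = KaehlerDifferential.D ℂ B 0
               rw [e.exact.apply_apply_eq_zero, map_zero]⟩
             map_zero' := Subtype.ext (by simp)
             map_add' := fun y z => Subtype.ext (by simp) }
      πsurj := fun b => by
        obtain ⟨x, hx⟩ := e.psurj (KaehlerDifferential.D ℂ B b)
        exact ⟨⟨(b, x), hx⟩, rfl⟩
      jinj := fun y z h => e.ιinj (TrivSqZeroExt.inr_injective (congrArg Subtype.val h))
      ker_eq := by
        rintro ⟨⟨b, x⟩, hx⟩
        constructor
        · intro h
          obtain rfl : b = 0 := h
          obtain ⟨y, rfl⟩ := (e.exact x).1 (hx.trans (map_zero _))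
          exact ⟨y, rfl⟩
        · rintro ⟨y, hy⟩
          exact (congrArg (fun o : P => o.1.fst) hy).symm
      sq_zero := fun y z => Subtype.ext (TrivSqZeroExt.inr_mul_inr B _ _)
      smul_compat := fun o y => Subtype.ext (by
        change o.1 * TrivSqZeroExt.inr (e.ι y) = TrivSqZeroExt.inr (e.ι (o.1.fst • y))
        ext <;> simp) }
  refine ⟨X, ⟨⟨fun o => o.1.snd, rfl⟩, fun _ _ => rfl⟩, fun c => ?_, fun a b => ?_,
    fun y => rfl, fun o => o.2⟩
  · change (algebraMap ℂ (TrivSqZeroExt B e.E) c).snd = 0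
    simp [TrivSqZeroExt.algebraMap_eq_inl']
  · change (a.1 * b.1).snd = a.1.fst • b.1.snd + b.1.fst • a.1.snd
    simp

/-- The `X.O`-algebra structure on `B` given by the projection of `X`. -/
abbrev algebraBase (X : SqZeroExtension B I) : Algebra X.O B := X.π.toRingHom.toAlgebra

theorem isScalarTower_algebraBase (X : SqZeroExtension B I) :
    letI := X.algebraBase
    IsScalarTower ℂ X.O B :=
  letI := X.algebraBase
  IsScalarTower.of_algebraMap_eq fun c => (X.π.commutes c).symm

theorem one_tmul_smul (X : SqZeroExtension B I) (o : X.O) (ω : Ω[X.O⁄ℂ]) :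
    letI := X.algebraBase
    (1 : B) ⊗ₜ[X.O] (o • ω) = X.π o • ((1 : B) ⊗ₜ[X.O] ω) := by
  let := X.algebraBase
  rw [← TensorProduct.smul_tmul, TensorProduct.smul_tmul', Algebra.smul_def, smul_eq_mul]
  rfl

/-- The conormal sequence of a square-zero extension of a reduced algebra of finite type by a
projective module. -/
def conormal [IsReduced B] [Algebra.FiniteType ℂ B] [Module.Projective B I]
    (X : SqZeroExtension B I) : ModuleExtension B (Ω[B⁄ℂ]) I :=
  letI := X.algebraBase
  haveI := X.isScalarTower_algebraBase
  { E := B ⊗[X.O] Ω[X.O⁄ℂ]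
    ι := { toFun := fun y => 1 ⊗ₜ KaehlerDifferential.D ℂ X.O (X.j y)
           map_add' := fun y z => by rw [map_add, map_add, TensorProduct.tmul_add]
           map_smul' := fun b y => by
             obtain ⟨o, rfl⟩ := X.πsurj b
             rw [← X.smul_compat, Derivation.leibniz, TensorProduct.tmul_add, X.one_tmul_smul,
               X.one_tmul_smul, X.π_j, zero_smul, add_zero, RingHom.id_apply] }
    p := KaehlerDifferential.mapBaseChange ℂ X.O B
    ιinj := by
      rw [injective_iff_map_eq_zero]
      intro y hy
      refine one_tmul_D_injective X.πsurj (fun x y hx hy => ?_) X.j X.jinj X.π_j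
        X.smul_compat y hy
      obtain ⟨x, rfl⟩ := (X.ker_eq x).1 hx
      obtain ⟨y, rfl⟩ := (X.ker_eq y).1 hy
      exact X.sq_zero x y
    psurj := KaehlerDifferential.mapBaseChange_surjective ℂ X.O B X.πsurj
    exact := by
      intro x
      rw [KaehlerDifferential.exact_kerCotangentToTensor_mapBaseChange ℂ X.O B X.πsurj x]
      constructor
      · rintro ⟨c, rfl⟩
        obtain ⟨⟨o, ho⟩, rfl⟩ := Ideal.toCotangent_surjective _ c
        obtain ⟨y, rfl⟩ := (X.ker_eq o).1 ho
        exact ⟨y, rfl⟩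
      · rintro ⟨y, rfl⟩
        exact ⟨Ideal.toCotangent _ ⟨X.j y, X.π_j y⟩, rfl⟩ }

theorem compatible_of_isConormalSequence {X : SqZeroExtension B I}
    {e : ModuleExtension B (Ω[B⁄ℂ]) I} (h : IsConormalSequence X e) : X.Compatible e := by
  let := X.algebraBase
  obtain ⟨φ, hι, hp⟩ := h
  refine ⟨⟨⟨fun o => φ.symm (1 ⊗ₜ KaehlerDifferential.D ℂ X.O o), ?_⟩, fun a b => ?_⟩,
    fun c => ?_, fun a b => ?_, fun y => ?_, fun o => ?_⟩
  · rw [map_zero, TensorProduct.tmul_zero, map_zero]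
  · simp only [map_add, TensorProduct.tmul_add]
  · change φ.symm (1 ⊗ₜ KaehlerDifferential.D ℂ X.O _) = 0
    rw [Derivation.map_algebraMap, TensorProduct.tmul_zero, map_zero]
  · change φ.symm (1 ⊗ₜ KaehlerDifferential.D ℂ X.O (a * b)) =
      X.π a • φ.symm (1 ⊗ₜ KaehlerDifferential.D ℂ X.O b) +
      X.π b • φ.symm (1 ⊗ₜ KaehlerDifferential.D ℂ X.O a)
    rw [Derivation.leibniz, TensorProduct.tmul_add, X.one_tmul_smul, X.one_tmul_smul, map_add,
      map_smul, map_smul]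
  · exact (LinearEquiv.symm_apply_eq φ).2 (hι y).symm
  · exact (hp 1 o).trans (one_smul _ _)

section

variable [IsReduced B] [Algebra.FiniteType ℂ B] [Module.Projective B I]

theorem isConormalSequence_conormal (X : SqZeroExtension B I) :
    IsConormalSequence X X.conormal := by
  let := X.algebraBase
  have := X.isScalarTower_algebraBase
  refine ⟨LinearEquiv.refl B _, fun y => rfl, fun b o => ?_⟩
  change KaehlerDifferential.mapBaseChange ℂ X.O B (b ⊗ₜ KaehlerDifferential.D ℂ X.O o) = _
  rw [KaehlerDifferential.mapBaseChange_tmul, KaehlerDifferential.map_D]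
  rfl

theorem compatible_conormal (X : SqZeroExtension B I) : X.Compatible X.conormal :=
  compatible_of_isConormalSequence X.isConormalSequence_conormal

theorem Compatible.conormal_iso {X : SqZeroExtension B I}
    {e : ModuleExtension B (Ω[B⁄ℂ]) I} (h : X.Compatible e) : X.conormal.Iso e := by
  obtain ⟨δ, h1, h2, h3, h4⟩ := h
  let := X.algebraBase
  have := X.isScalarTower_algebraBase
  let : Module X.O e.E := Module.compHom e.E (algebraMap X.O B)
  let : Module ℂ e.E := Module.compHom e.E (algebraMap ℂ B)
  have : IsScalarTower X.O B e.E := IsScalarTower.of_algebraMap_smul fun _ _ => rfl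
  have : IsScalarTower ℂ B e.E := IsScalarTower.of_algebraMap_smul fun _ _ => rfl
  have : IsScalarTower ℂ X.O e.E := IsScalarTower.of_algebraMap_smul fun c x => by
    rw [← algebraMap_smul B, ← IsScalarTower.algebraMap_apply, algebraMap_smul]
  let d : Derivation ℂ X.O e.E := Derivation.mk'
    { toFun := δ
      map_add' := map_add δ
      map_smul' := fun c o => by
        rw [Algebra.smul_def, h2, h1, smul_zero, add_zero, AlgHom.commutes, algebraMap_smul,
          RingHom.id_apply] } h2
  refine ModuleExtension.iso_of_hom (d.liftKaehlerDifferential.liftBaseChange B)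
    (fun y => ?_) fun x => ?_
  · change (d.liftKaehlerDifferential.liftBaseChange B)
      (1 ⊗ₜ KaehlerDifferential.D ℂ X.O (X.j y)) = _
    rw [LinearMap.liftBaseChange_one_tmul, Derivation.liftKaehlerDifferential_comp_D]
    exact h3 y
  · revert x
    change ∀ x : B ⊗[X.O] Ω[X.O⁄ℂ], e.p (d.liftKaehlerDifferential.liftBaseChange B x) =
      KaehlerDifferential.mapBaseChange ℂ X.O B x
    intro x
    induction x using TensorProduct.induction_on with
    | zero => simp only [map_zero]
    | add x y hx hy => simp only [map_add, hx, hy]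
    | tmul b ω =>
      rw [LinearMap.liftBaseChange_tmul, KaehlerDifferential.mapBaseChange_tmul, map_smul]
      congr 1
      have hω : ω ∈ Submodule.span X.O (Set.range (KaehlerDifferential.D ℂ X.O)) := by
        rw [KaehlerDifferential.span_range_derivation]
        exact Submodule.mem_top
      induction hω using Submodule.span_induction with
      | mem ω h =>
        obtain ⟨o, rfl⟩ := h
        rw [Derivation.liftKaehlerDifferential_comp_D, KaehlerDifferential.map_D]
        exact h4 o
      | zero => simp only [map_zero]
      | add x y _ _ hx hy => simp only [map_add, hx, hy]
      | smul o x _ hx =>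
        rw [(KaehlerDifferential.map ℂ ℂ X.O B).map_smul, ← hx, map_smul,
          ← algebraMap_smul B o (d.liftKaehlerDifferential x), map_smul, algebraMap_smul]

end

end SqZeroExtension

/-- for `B` a reduced commutative `ℂ`-algebra of finite type and `I` a
finitely generated projective `B`-module, assigning to a square-zero extension
`0 → I → O′ → B → 0` the class of its conormal sequence
`0 → I → Ω_{O′/ℂ} ⊗_{O′} B → Ω_{B/ℂ} → 0` in `Ext¹_B(Ω_{B/ℂ}, I)` (realized as the group
of equivalence classes of `B`-module extensions of `Ω_{B/ℂ}` by `I`) is a bijection from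
the set of isomorphism classes of square-zero extensions of `B` by `I`. -/
theorem stmt9 (B I : Type u) [CommRing B] [Algebra ℂ B] [IsReduced B]
    [Algebra.FiniteType ℂ B]
    [AddCommGroup I] [Module B I] [Module.Finite B I] [Module.Projective B I] :
    ∃ Φ : Quot (SqZeroExtension.Iso (B := B) (I := I)) →
        Quot (ModuleExtension.Iso (B := B) (F := Ω[B⁄ℂ]) (G := I)),
      Function.Bijective Φ ∧
      ∀ (X : SqZeroExtension B I) (ext : ModuleExtension B (Ω[B⁄ℂ]) I),
        IsConormalSequence X ext → Φ (Quot.mk _ X) = Quot.mk _ ext := by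
  refine ⟨Quot.map SqZeroExtension.conormal fun X X' h =>
    ((SqZeroExtension.compatible_conormal X').of_iso_left h).conormal_iso, ⟨?_, ?_⟩, ?_⟩
  · rintro ⟨X⟩ ⟨X'⟩ h
    have h' := (ModuleExtension.Iso.equivalence.quot_mk_eq_iff _ _).1 h
    exact Quot.sound
      (((SqZeroExtension.compatible_conormal X).of_iso_right h').iso
        (SqZeroExtension.compatible_conormal X'))
  · rintro ⟨e⟩
    obtain ⟨X, hX⟩ := SqZeroExtension.exists_compatible e
    exact ⟨Quot.mk _ X, Quot.sound hX.conormal_iso⟩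
  · intro X e h
    exact Quot.sound (SqZeroExtension.compatible_of_isConormalSequence h).conormal_iso
end
end

section
/- Let B be a reduced commutative ℂ-algebra of finite type, let Õ be a flat ℂ[ε]/(ε²)-algebra together with an isomorphism Õ ⊗_{ℂ[ε]/(ε²)} ℂ ≅ B, let M̃ be an invertible (rank-one finitely generated projective) Õ-module, and let M = M̃ ⊗_Õ B. Let P¹_{Õ/ℂ}(M̃) = ((Õ ⊗_ℂ Õ)/J²) ⊗_Õ M̃ where J is the kernel of the multiplication map Õ ⊗_ℂ Õ → Õ and the tensor product is formed using the right-factor Õ-module structure, regarded as an Õ-module via the left factor; define P¹_{B/ℂ}(M) analogously. Then the natural restriction map r : P¹_{Õ/ℂ}(M̃) ⊗_Õ B → P¹_{B/ℂ}(M) is surjective and its kernel is isomorphic to M as a B-module, so there is a short exact sequence of B-modules 0 → M → P¹_{Õ/ℂ}(M̃) ⊗_Õ B → P¹_{B/ℂ}(M) → 0. -/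
open TensorProduct

noncomputable section

section JetInfrastructure

variable (A R : Type*) [CommRing A] [CommRing R] [Algebra A R]

/-- The ring of one-jets `(R ⊗[A] R) ⧸ I²`, an `R`-algebra via the left tensor factor,
where `I` is the kernel of the multiplication map `R ⊗[A] R → R`. -/
abbrev JetAlgebra := (R ⊗[A] R) ⧸ (KaehlerDifferential.ideal A R ^ 2)

/-- `(R ⊗[A] R) ⧸ I²` regarded as an `R`-module via the *right* tensor factor. -/
def JetRight : Type _ := JetAlgebra A R

instance : AddCommGroup (JetRight A R) := inferInstanceAs (AddCommGroup (JetAlgebra A R))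

/-- The right inclusion `R → (R ⊗[A] R)/I²`, `r ↦ [1 ⊗ r]`. -/
def jetRightHom : R →+* JetAlgebra A R :=
  (Ideal.Quotient.mk (KaehlerDifferential.ideal A R ^ 2)).comp
    (Algebra.TensorProduct.includeRight (R := A) (A := R) (B := R)).toRingHom

/-- The right-factor `R`-module structure. -/
instance : Module R (JetRight A R) :=
  Module.compHom (JetAlgebra A R) (jetRightHom A R)

instance : Module (JetAlgebra A R) (JetRight A R) :=
  inferInstanceAs (Module (JetAlgebra A R) (JetAlgebra A R))

instance : SMulCommClass R (JetAlgebra A R) (JetRight A R) := by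
  constructor
  intro r q x
  show jetRightHom A R r * (q * (show JetAlgebra A R from x)) =
    q * (jetRightHom A R r * (show JetAlgebra A R from x))
  ring

variable (N : Type*) [AddCommGroup N] [Module R N]

/-- The module of one-jets `P¹_{R/A}(N) = ((R ⊗[A] R)/I²) ⊗[R] N`, the tensor product
being taken with respect to the right-factor `R`-module structure of `(R ⊗[A] R)/I²`. -/
def JetModule : Type _ := JetRight A R ⊗[R] N

instance : AddCommGroup (JetModule A R N) :=
  inferInstanceAs (AddCommGroup (JetRight A R ⊗[R] N))

instance : Module (JetAlgebra A R) (JetModule A R N) :=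
  inferInstanceAs (Module (JetAlgebra A R) (JetRight A R ⊗[R] N))

/-- The *left* `R`-module structure on `P¹_{R/A}(N)`, via the left tensor factor. -/
instance : Module R (JetModule A R N) :=
  Module.compHom (JetRight A R ⊗[R] N) (algebraMap R (JetAlgebra A R))

variable {A R N}

/-- The class of `x ⊗ n` in `P¹_{R/A}(N)`. -/
def JetModule.mk (x : R ⊗[A] R) (n : N) : JetModule A R N :=
  (show JetRight A R from
    Ideal.Quotient.mk (KaehlerDifferential.ideal A R ^ 2) x) ⊗ₜ[R] n

/-- The one-jet map `p₁ : N → P¹_{R/A}(N)`, `n ↦ [1 ⊗ 1] ⊗ n`. -/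
def jetOne (A : Type*) [CommRing A] {R N : Type*} [CommRing R] [Algebra A R]
    [AddCommGroup N] [Module R N] (n : N) : JetModule A R N :=
  JetModule.mk (1 : R ⊗[A] R) n

end JetInfrastructure

/-- An invertible module: a rank-one finitely generated projective module. -/
def IsInvertibleModule (R M : Type*) [CommRing R] [AddCommGroup M] [Module R M] : Prop :=
  Module.Finite R M ∧ Module.Projective R M ∧
    ∀ (p : Ideal R) (hp : p.IsPrime),
      Module.finrank (Localization (p.primeCompl (hp := hp)))
        (LocalizedModule (p.primeCompl (hp := hp)) M) = 1

open scoped DualNumber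

section Sections

open IsLocalRing

variable {k : Type*} [Field k] [PerfectField k]

/-- A local algebra over a perfect field whose maximal ideal is square-zero contains a copy of
its residue field, provided the latter is essentially of finite type. -/
theorem exists_residueField_section {L : Type*} [CommRing L] [IsLocalRing L] [Algebra k L]
    [Algebra.EssFiniteType k (ResidueField L)] (h : maximalIdeal L ^ 2 = ⊥) :
    ∃ s : ResidueField L →ₐ[k] L, ∀ x, residue L (s x) = x := by
  obtain ⟨s, hs⟩ := Algebra.FormallySmooth.exists_lift (R := k) (A := ResidueField L)
    (maximalIdeal L) ⟨2, h⟩ (AlgHom.id k (ResidueField L))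
  exact ⟨s, fun x => AlgHom.congr_fun hs x⟩

/-- If `q` is a prime of `O` which is locally generated by a square-zero element `e`, then
`O → O_q` is congruent, modulo a square-zero ideal, to a homomorphism killing `e`. -/
theorem exists_algHom_localization {O : Type*} [CommRing O] [Algebra k O] {e : O}
    (he : e * e = 0) (q : Ideal O) [q.IsPrime] [Algebra.FiniteType k (O ⧸ q)]
    (hq : ∀ x ∈ q, ∃ s ∉ q, ∃ y, s * x = e * y) :
    ∃ σ : O →ₐ[k] Localization.AtPrime q, σ e = 0 ∧
      ∀ y z, (algebraMap O (Localization.AtPrime q) y - σ y) *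
        (algebraMap O (Localization.AtPrime q) z - σ z) = 0 := by
  set L := Localization.AtPrime q
  have hmem : ∀ x ∈ maximalIdeal L, ∃ y, x = algebraMap O L e * y := by
    intro x hx
    obtain ⟨a, t, rfl⟩ := IsLocalization.exists_mk'_eq q.primeCompl x
    rw [IsLocalization.AtPrime.mk'_mem_maximal_iff L q] at hx
    obtain ⟨s, hs, y, hy⟩ := hq a hx
    refine ⟨IsLocalization.mk' L y (⟨s, hs⟩ * t), ?_⟩
    rw [IsLocalization.mul_mk'_eq_mk'_of_mul, ← hy]
    rw [mul_comm s, mul_comm _ t]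
    exact (IsLocalization.mk'_cancel a t ⟨s, hs⟩).symm
  have hmul : ∀ x ∈ maximalIdeal L, ∀ y ∈ maximalIdeal L, x * y = 0 := by
    intro x hx y hy
    obtain ⟨x, rfl⟩ := hmem x hx
    obtain ⟨y, rfl⟩ := hmem y hy
    rw [mul_mul_mul_comm, ← map_mul, he, map_zero, zero_mul]
  have hsq : maximalIdeal L ^ 2 = ⊥ := by
    rw [pow_two, eq_bot_iff, Ideal.mul_le]
    exact fun x hx y hy => (Ideal.mem_bot).2 (hmul x hx y hy)
  have : Algebra.EssFiniteType k q.ResidueField :=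
    have : Algebra.EssFiniteType (O ⧸ q) q.ResidueField :=
      .of_isLocalization _ (nonZeroDivisors (O ⧸ q))
    .comp k (O ⧸ q) q.ResidueField
  obtain ⟨s, hs⟩ := exists_residueField_section (k := k) (L := L) hsq
  let ρ : O →ₐ[k] ResidueField L := IsScalarTower.toAlgHom k O q.ResidueField
  have hρ : ∀ x, ρ x = residue L (algebraMap O L x) := fun x => rfl
  refine ⟨s.comp ρ, ?_, fun y z => ?_⟩
  · have : ρ e = 0 := by
      have h : ρ e * ρ e = 0 := by rw [← map_mul, he, map_zero]
      exact mul_self_eq_zero.1 h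
    rw [AlgHom.comp_apply, this, map_zero]
  · have key : ∀ y, algebraMap O L y - s (ρ y) ∈ maximalIdeal L := fun y => by
      rw [← residue_eq_zero_iff, map_sub, hs, hρ, sub_self]
    exact hmul _ (key y) _ (key z)

end Sections

section Jets

variable {A R : Type*} [CommRing A] [CommRing R] [Algebra A R]
variable {N : Type*} [AddCommGroup N] [Module R N]

namespace JetModule

theorem mk_add (x y : R ⊗[A] R) (n : N) : mk (x + y) n = mk x n + mk y n :=
  (TensorProduct.add_tmul (R := R)
    (show JetRight A R from Ideal.Quotient.mk (KaehlerDifferential.ideal A R ^ 2) x)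
    (show JetRight A R from Ideal.Quotient.mk (KaehlerDifferential.ideal A R ^ 2) y) n :)

theorem mk_add_right (x : R ⊗[A] R) (m n : N) : mk x (m + n) = mk x m + mk x n :=
  TensorProduct.tmul_add (R := R) _ _ _

theorem mk_zero (n : N) : mk (0 : R ⊗[A] R) n = 0 :=
  TensorProduct.zero_tmul (R := R) _ _

theorem mk_congr {x y : R ⊗[A] R} (h : x - y ∈ KaehlerDifferential.ideal A R ^ 2) (n : N) :
    mk x n = mk y n :=
  congrArg (fun u : JetRight A R => u ⊗ₜ[R] n) (Ideal.Quotient.eq.2 h)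

theorem smul_mk (a : R) (x : R ⊗[A] R) (n : N) : a • mk x n = mk (a ⊗ₜ 1 * x) n := rfl

theorem mk_smul (a : R) (x : R ⊗[A] R) (n : N) : mk x (a • n) = mk (1 ⊗ₜ a * x) n :=
  (TensorProduct.smul_tmul (R := R) a
    (show JetRight A R from Ideal.Quotient.mk (KaehlerDifferential.ideal A R ^ 2) x) n).symm

@[elab_as_elim]
theorem induction {P : JetModule A R N → Prop} (zero : P 0)
    (add : ∀ x y, P x → P y → P (x + y)) (mk : ∀ x n, P (mk x n)) (p : JetModule A R N) : P p := by
  refine TensorProduct.induction_on (R := R) (motive := P) p zero (fun u n => ?_) add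
  obtain ⟨x, rfl⟩ := Ideal.Quotient.mk_surjective (show JetAlgebra A R from u)
  exact mk x n

end JetModule

/-- Two algebra maps which are congruent modulo a square-zero ideal induce a map from the ring
of one-jets. -/
def jetAlgebraLift {L : Type*} [CommRing L] [Algebra A L] (σ j : R →ₐ[A] L)
    (h : ∀ y z, (j y - σ y) * (j z - σ z) = 0) : JetAlgebra A R →+* L :=
  Ideal.Quotient.lift _ (Algebra.TensorProduct.productMap σ j).toRingHom <| by
    have hle : KaehlerDifferential.ideal A R ^ 2 ≤
        RingHom.ker (Algebra.TensorProduct.productMap σ j).toRingHom := by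
      rw [← KaehlerDifferential.span_range_eq_ideal, pow_two, Ideal.span_mul_span', Ideal.span_le]
      rintro _ ⟨_, ⟨y, rfl⟩, _, ⟨z, rfl⟩, rfl⟩
      simpa [RingHom.mem_ker] using h y z
    exact fun a ha => hle ha

/-- The pairing of one-jets with a linear functional, along `jetAlgebraLift`. -/
def jetModuleLift {L : Type*} [CommRing L] [Algebra A L] (σ j : R →ₐ[A] L)
    (h : ∀ y z, (j y - σ y) * (j z - σ z) = 0) (l : N →ₗ[R] R) : JetModule A R N →+ L :=
  TensorProduct.liftAddHom (R := R) (M := JetRight A R) (N := N)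
    ((AddMonoidHom.mul.comp (jetAlgebraLift σ j h).toAddMonoidHom).compl₂
      (j.toRingHom.toAddMonoidHom.comp l.toAddMonoidHom))
    (by
      intro r u n
      obtain ⟨x, rfl⟩ := Ideal.Quotient.mk_surjective (show JetAlgebra A R from u)
      change jetAlgebraLift σ j h (Ideal.Quotient.mk _ (1 ⊗ₜ r * x)) * j (l n) =
        jetAlgebraLift σ j h (Ideal.Quotient.mk _ x) * j (l (r • n))
      simp [map_mul, jetAlgebraLift]
      ring)

theorem jetModuleLift_mk {L : Type*} [CommRing L] [Algebra A L] (σ j : R →ₐ[A] L)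
    (h : ∀ y z, (j y - σ y) * (j z - σ z) = 0) (l : N →ₗ[R] R) (x : R ⊗[A] R) (n : N) :
    jetModuleLift σ j h l (JetModule.mk x n) =
      Algebra.TensorProduct.productMap σ j x * j (l n) := rfl

theorem jetModuleLift_smul {L : Type*} [CommRing L] [Algebra A L] (σ j : R →ₐ[A] L)
    (h : ∀ y z, (j y - σ y) * (j z - σ z) = 0) (l : N →ₗ[R] R) (a : R) (p : JetModule A R N) :
    jetModuleLift σ j h l (a • p) = σ a * jetModuleLift σ j h l p := by
  induction p using JetModule.induction with
  | zero => simp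
  | add x y hx hy => rw [smul_add, map_add, map_add, hx, hy, mul_add]
  | mk x n => simp [JetModule.smul_mk, jetModuleLift_mk, map_mul, mul_assoc]

end Jets

section BaseChange

variable {A O B : Type*} [CommRing A] [CommRing O] [CommRing B] [Algebra A O] [Algebra O B]
variable {M : Type*} [AddCommGroup M] [Module O M]

theorem one_tmul_smul_eq_zero {P : Type*} [AddCommGroup P] [Module O P] {e : O}
    (he : algebraMap O B e = 0) (p : P) :
    (1 : B) ⊗ₜ[O] (e • p) = 0 := by
  rw [← TensorProduct.smul_tmul, Algebra.smul_def, he, zero_mul, TensorProduct.zero_tmul]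

/-- Multiplication by the class of `1 ⊗ e`, as a map `M ⊗ B → P¹_{O/A}(M) ⊗ B`; it is linear
when `e` vanishes in `B`. -/
def jetKernelMap (A M : Type*) [CommRing A] [Algebra A O] [AddCommGroup M] [Module O M] (e : O) (he : algebraMap O B e = 0) :
    B ⊗[O] M →ₗ[B] B ⊗[O] JetModule A O M :=
  LinearMap.liftBaseChange B
    { toFun := fun m => 1 ⊗ₜ JetModule.mk (1 ⊗ₜ e) m
      map_add' := fun m n => by rw [JetModule.mk_add_right, TensorProduct.tmul_add]
      map_smul' := fun o m => by
        have h : (JetModule.mk (1 ⊗ₜ o * 1 ⊗ₜ e) m : JetModule A O M) =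
            JetModule.mk (o ⊗ₜ 1 * 1 ⊗ₜ e + e ⊗ₜ 1 * (1 ⊗ₜ o - o ⊗ₜ 1)) m := by
          refine JetModule.mk_congr ?_ m
          have := Ideal.mul_mem_mul (KaehlerDifferential.one_smul_sub_smul_one_mem_ideal A o)
            (KaehlerDifferential.one_smul_sub_smul_one_mem_ideal A e)
          rw [← pow_two] at this
          convert this using 1
          ring
        rw [JetModule.mk_smul, h, JetModule.mk_add, TensorProduct.tmul_add,
          ← JetModule.smul_mk e, one_tmul_smul_eq_zero he, add_zero, ← JetModule.smul_mk,
          TensorProduct.tmul_smul, RingHom.id_apply] }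

theorem jetKernelMap_tmul {e : O} (he : algebraMap O B e = 0) (b : B) (m : M) :
    jetKernelMap A M e he (b ⊗ₜ m) = b ⊗ₜ JetModule.mk (1 ⊗ₜ e) m := by
  change b • ((1 : B) ⊗ₜ[O] JetModule.mk (1 ⊗ₜ e) m) = _
  rw [TensorProduct.smul_tmul', smul_eq_mul, mul_one]

variable [Algebra A B] [IsScalarTower A O B]

/-- The map `O ⊗ O → B ⊗ B` induced by `O → B`. -/
abbrev tensorSquareMap (A O B : Type*) [CommRing A] [CommRing O] [CommRing B] [Algebra A O]
    [Algebra A B] [Algebra O B] [IsScalarTower A O B] : O ⊗[A] O →ₐ[A] B ⊗[A] B :=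
  Algebra.TensorProduct.map (IsScalarTower.toAlgHom A O B) (IsScalarTower.toAlgHom A O B)

theorem tensorSquareMap_one_sub (s : O) :
    tensorSquareMap A O B (1 ⊗ₜ s - s ⊗ₜ 1) =
      1 ⊗ₜ algebraMap O B s - algebraMap O B s ⊗ₜ 1 := by
  simp

theorem map_ideal_le :
    (KaehlerDifferential.ideal A O).map (tensorSquareMap A O B) ≤ KaehlerDifferential.ideal A B := by
  rw [← KaehlerDifferential.span_range_eq_ideal, ← KaehlerDifferential.span_range_eq_ideal,
    Ideal.map_span, Ideal.span_le]
  rintro _ ⟨_, ⟨s, rfl⟩, rfl⟩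
  exact Ideal.subset_span ⟨algebraMap O B s, (tensorSquareMap_one_sub s).symm⟩

theorem map_ideal_eq (hπ : Function.Surjective (algebraMap O B)) :
    (KaehlerDifferential.ideal A O).map (tensorSquareMap A O B) = KaehlerDifferential.ideal A B := by
  refine map_ideal_le.antisymm ?_
  rw [← KaehlerDifferential.span_range_eq_ideal, ← KaehlerDifferential.span_range_eq_ideal,
    Ideal.map_span, Ideal.span_le]
  rintro _ ⟨s, rfl⟩
  obtain ⟨s, rfl⟩ := hπ s
  exact Ideal.subset_span ⟨_, ⟨s, rfl⟩, tensorSquareMap_one_sub s⟩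

/-- The map between rings of one-jets induced by `O → B`. -/
def jetAlgebraMap (A O B : Type*) [CommRing A] [CommRing O] [CommRing B] [Algebra A O]
    [Algebra A B] [Algebra O B] [IsScalarTower A O B] : JetAlgebra A O →+* JetAlgebra A B :=
  Ideal.quotientMap _ (tensorSquareMap A O B).toRingHom <| by
    refine Ideal.map_le_iff_le_comap.1 ?_
    rw [Ideal.map_pow]
    exact Ideal.pow_right_mono map_ideal_le 2

theorem jetAlgebraMap_mk (x : O ⊗[A] O) :
    jetAlgebraMap A O B (Ideal.Quotient.mk _ x) = Ideal.Quotient.mk _ (tensorSquareMap A O B x) :=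
  rfl

theorem tensorSquareMap_surjective (hπ : Function.Surjective (algebraMap O B)) :
    Function.Surjective (tensorSquareMap A O B) :=
  TensorProduct.map_surjective hπ hπ

theorem jetAlgebraMap_surjective (hπ : Function.Surjective (algebraMap O B)) :
    Function.Surjective (jetAlgebraMap A O B) := by
  intro u
  obtain ⟨x, rfl⟩ := Ideal.Quotient.mk_surjective u
  obtain ⟨x, rfl⟩ := tensorSquareMap_surjective hπ x
  exact ⟨_, jetAlgebraMap_mk x⟩

theorem exists_of_jetAlgebraMap_eq_zero (hπ : Function.Surjective (algebraMap O B)) {e : O}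
    (hker : ∀ o : O, algebraMap O B o = 0 → ∃ o', o = e * o') (u : JetAlgebra A O)
    (hu : jetAlgebraMap A O B u = 0) :
    ∃ x y : O ⊗[A] O, u = Ideal.Quotient.mk _ (e ⊗ₜ 1 * x + 1 ⊗ₜ e * y) := by
  obtain ⟨w, rfl⟩ := Ideal.Quotient.mk_surjective u
  rw [jetAlgebraMap_mk, Ideal.Quotient.eq_zero_iff_mem, ← map_ideal_eq hπ, ← Ideal.map_pow,
    Ideal.mem_map_iff_of_surjective _ (tensorSquareMap_surjective hπ)] at hu
  obtain ⟨v, hv, hvw⟩ := hu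
  have hmem : w - v ∈ RingHom.ker (tensorSquareMap A O B) := by
    rw [RingHom.mem_ker, map_sub, hvw, sub_self]
  rw [Algebra.TensorProduct.map_ker _ _ hπ hπ] at hmem
  have hle : RingHom.ker (IsScalarTower.toAlgHom A O B) ≤ Ideal.span {e} := fun o ho =>
    Ideal.mem_span_singleton'.2 <| (hker o ho).imp fun o' h => by rw [h, mul_comm]
  have hmem' := sup_le_sup (Ideal.map_mono (f := Algebra.TensorProduct.includeLeft) hle)
    (Ideal.map_mono (f := Algebra.TensorProduct.includeRight) hle) hmem
  rw [Ideal.map_span, Ideal.map_span, Set.image_singleton, Set.image_singleton,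
    Submodule.mem_sup] at hmem'
  obtain ⟨a, ha, b, hb, hab⟩ := hmem'
  obtain ⟨x, rfl⟩ := Ideal.mem_span_singleton'.1 ha
  obtain ⟨y, rfl⟩ := Ideal.mem_span_singleton'.1 hb
  refine ⟨x, y, Ideal.Quotient.eq.2 ?_⟩
  have : w - (e ⊗ₜ 1 * x + 1 ⊗ₜ e * y) = v := by
    rw [mul_comm _ x, mul_comm _ y]
    exact sub_eq_iff_eq_add.2 (by rw [← sub_eq_iff_eq_add', ← hab]; rfl)
  rwa [this]

theorem isScalarTower_compHom {N : Type*} [AddCommGroup N] [Module B N] :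
    letI : Module O N := Module.compHom N (algebraMap O B)
    IsScalarTower O B N :=
  letI : Module O N := Module.compHom N (algebraMap O B)
  ⟨fun o b u => by rw [Algebra.smul_def, mul_smul]; rfl⟩

/-- `jetAlgebraMap`, as a linear map for the right-factor module structures. -/
def jetRightMap [Module O (JetRight A B)] [IsScalarTower O B (JetRight A B)] :
    JetRight A O →ₗ[O] JetRight A B where
  toFun := jetAlgebraMap A O B
  map_add' := map_add (jetAlgebraMap A O B)
  map_smul' o u := by
    refine Eq.trans ?_ (algebraMap_smul B o (show JetRight A B from jetAlgebraMap A O B u))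
    change jetAlgebraMap A O B (jetRightHom A O o * (show JetAlgebra A O from u)) =
      jetRightHom A B (algebraMap O B o) * jetAlgebraMap A O B u
    rw [map_mul]
    congr 1
    change jetAlgebraMap A O B (Ideal.Quotient.mk _ (1 ⊗ₜ o)) =
      Ideal.Quotient.mk _ (1 ⊗ₜ algebraMap O B o)
    simp [jetAlgebraMap_mk]

/-- The restriction map `P¹_{O/A}(M) → P¹_{B/A}(B ⊗ M)`, as an additive map. -/
def jetRestrict (A O B M : Type*) [CommRing A] [CommRing O] [CommRing B] [Algebra A O]
    [Algebra A B] [Algebra O B] [IsScalarTower A O B] [AddCommGroup M] [Module O M] :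
    JetModule A O M →+ JetModule A B (B ⊗[O] M) :=
  letI : Module O (JetRight A B) := Module.compHom _ (algebraMap O B)
  haveI : IsScalarTower O B (JetRight A B) := isScalarTower_compHom
  ((TensorProduct.AlgebraTensorModule.cancelBaseChange O B B
    (JetRight A B) M).symm.toAddMonoidHom).comp
    (jetRightMap.rTensor M : JetRight A O ⊗[O] M →ₗ[O] JetRight A B ⊗[O] M).toAddMonoidHom

theorem jetRestrict_mk (x : O ⊗[A] O) (m : M) :
    jetRestrict A O B M (JetModule.mk x m) =
      JetModule.mk (tensorSquareMap A O B x) ((1 : B) ⊗ₜ[O] m) := rfl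

theorem jetRestrict_surjective (hπ : Function.Surjective (algebraMap O B)) :
    Function.Surjective (jetRestrict A O B M) :=
  letI : Module O (JetRight A B) := Module.compHom _ (algebraMap O B)
  haveI : IsScalarTower O B (JetRight A B) := isScalarTower_compHom
  (TensorProduct.AlgebraTensorModule.cancelBaseChange O B B
    (JetRight A B) M).symm.surjective.comp
    (LinearMap.rTensor_surjective M (g := jetRightMap) (jetAlgebraMap_surjective hπ))

/-- The kernel of the restriction map is additively generated by the multiples of
`e ⊗ 1` and `1 ⊗ e`. -/
theorem jetRestrict_ker_induction (hπ : Function.Surjective (algebraMap O B)) {e : O}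
    (hker : ∀ o : O, algebraMap O B o = 0 → ∃ o', o = e * o')
    {P : JetModule A O M → Prop} (zero : P 0) (add : ∀ p q, P p → P q → P (p + q))
    (mk : ∀ x y m, P (JetModule.mk (e ⊗ₜ 1 * x + 1 ⊗ₜ e * y) m)) (p : JetModule A O M)
    (hp : jetRestrict A O B M p = 0) : P p := by
  let _ : Module O (JetRight A B) := Module.compHom _ (algebraMap O B)
  have : IsScalarTower O B (JetRight A B) := isScalarTower_compHom
  have hp' : (jetRightMap (A := A) (O := O) (B := B)).rTensor M p = 0 :=
    (TensorProduct.AlgebraTensorModule.cancelBaseChange O B B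
      (JetRight A B) M).symm.map_eq_zero_iff.1 hp
  obtain ⟨z, hz⟩ := (rTensor_exact M
    (LinearMap.exact_subtype_ker_map (jetRightMap (A := A) (O := O) (B := B)))
    (jetAlgebraMap_surjective hπ) p).1 hp'
  rw [← hz]
  clear hz hp hp' p
  induction z using TensorProduct.induction_on with
  | zero => rw [map_zero]; exact zero
  | add z w hz hw => rw [map_add]; exact add _ _ hz hw
  | tmul u m =>
    obtain ⟨u, hu⟩ := u
    obtain ⟨x, y, rfl⟩ := exists_of_jetAlgebraMap_eq_zero hπ hker u hu
    exact mk x y m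

theorem jetRestrict_smul (o : O) (p : JetModule A O M) :
    jetRestrict A O B M (o • p) = algebraMap O B o • jetRestrict A O B M p := by
  induction p using JetModule.induction with
  | zero => simp
  | add x y hx hy => rw [smul_add, map_add, map_add, hx, hy, smul_add]
  | mk x n =>
    rw [JetModule.smul_mk, jetRestrict_mk, jetRestrict_mk, map_mul, JetModule.smul_mk]
    simp


/-- The restriction map `P¹_{O/A}(M) ⊗ B → P¹_{B/A}(M ⊗ B)`. -/
def jetBaseChange (A O B M : Type*) [CommRing A] [CommRing O] [CommRing B] [Algebra A O]
    [Algebra A B] [Algebra O B] [IsScalarTower A O B] [AddCommGroup M] [Module O M] :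
    B ⊗[O] JetModule A O M →ₗ[B] JetModule A B (B ⊗[O] M) :=
  letI : Module O (JetModule A B (B ⊗[O] M)) := Module.compHom _ (algebraMap O B)
  haveI : IsScalarTower O B (JetModule A B (B ⊗[O] M)) := isScalarTower_compHom
  LinearMap.liftBaseChange B
    { jetRestrict A O B M with
      map_smul' := jetRestrict_smul }

theorem jetBaseChange_tmul (b : B) (p : JetModule A O M) :
    jetBaseChange A O B M (b ⊗ₜ p) = b • jetRestrict A O B M p := rfl

theorem exists_eq_one_tmul (hπ : Function.Surjective (algebraMap O B)) (z : B ⊗[O] M) :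
    ∃ m : M, z = 1 ⊗ₜ m :=
  (TensorProduct.mk_surjective O M B hπ z).imp fun _ => Eq.symm

theorem jetBaseChange_surjective (hπ : Function.Surjective (algebraMap O B)) :
    Function.Surjective (jetBaseChange A O B M) := fun z => by
  obtain ⟨p, rfl⟩ := jetRestrict_surjective hπ z
  exact ⟨1 ⊗ₜ p, by rw [jetBaseChange_tmul, one_smul]⟩

theorem jetKernelMap_exact (hπ : Function.Surjective (algebraMap O B)) {e : O}
    (he : algebraMap O B e = 0) (hker : ∀ o : O, algebraMap O B o = 0 → ∃ o', o = e * o') :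
    Function.Exact (jetKernelMap A M e he) (jetBaseChange A O B M) := by
  intro z
  constructor
  · intro hz
    obtain ⟨p, rfl⟩ := exists_eq_one_tmul hπ z
    rw [jetBaseChange_tmul, one_smul] at hz
    refine jetRestrict_ker_induction hπ hker
      (P := fun p => (1 : B) ⊗ₜ[O] p ∈ Set.range (jetKernelMap A M e he)) ?_ ?_ ?_ p hz
    · exact ⟨0, by rw [map_zero, TensorProduct.tmul_zero]⟩
    · rintro p q ⟨a, ha⟩ ⟨b, hb⟩
      exact ⟨a + b, by rw [map_add, ha, hb, TensorProduct.tmul_add]⟩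
    · intro x y m
      rw [JetModule.mk_add, ← JetModule.smul_mk, TensorProduct.tmul_add,
        one_tmul_smul_eq_zero he, zero_add]
      induction y using TensorProduct.induction_on with
      | zero => exact ⟨0, by rw [map_zero, mul_zero, JetModule.mk_zero, TensorProduct.tmul_zero]⟩
      | add p q hp hq =>
        obtain ⟨a, ha⟩ := hp
        obtain ⟨b, hb⟩ := hq
        exact ⟨a + b, by
          rw [map_add, ha, hb, ← TensorProduct.tmul_add, mul_add, JetModule.mk_add]⟩
      | tmul a b =>
        refine ⟨a • ((1 : B) ⊗ₜ (b • m)), ?_⟩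
        rw [LinearMap.map_smul_of_tower, jetKernelMap_tmul, ← TensorProduct.tmul_smul,
          JetModule.mk_smul, JetModule.smul_mk]
        simp [mul_comm]
  · rintro ⟨w, rfl⟩
    obtain ⟨m, rfl⟩ := exists_eq_one_tmul hπ w
    rw [jetKernelMap_tmul, jetBaseChange_tmul, jetRestrict_mk]
    simp [he, JetModule.mk_zero]

end BaseChange

section Injectivity

/-- A projective module's elements are determined, modulo a principal ideal, by their images
under linear functionals. -/
theorem exists_eq_smul_of_forall_dual {O M : Type*} [CommRing O] [AddCommGroup M] [Module O M]
    [Module.Projective O M] {e : O} (m : M) (h : ∀ l : M →ₗ[O] O, ∃ y, l m = e * y) :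
    ∃ m', m = e • m' := by
  obtain ⟨s, hs⟩ := Module.projective_def'.1 ‹Module.Projective O M›
  have hs' : Finsupp.linearCombination O id (s m) = m := LinearMap.congr_fun hs m
  choose y hy using fun i : M => h (Finsupp.lapply i ∘ₗ s)
  refine ⟨∑ i ∈ (s m).support, y i • i, ?_⟩
  conv_lhs => rw [← hs', Finsupp.linearCombination_apply, Finsupp.sum]
  rw [Finset.smul_sum]
  refine Finset.sum_congr rfl fun i _ => ?_
  rw [smul_smul, ← hy]
  rfl

theorem exists_eq_smul_of_one_tmul_eq_zero {O B P : Type*} [CommRing O] [CommRing B] [Algebra O B]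
    [AddCommGroup P] [Module O P] (hπ : Function.Surjective (algebraMap O B)) {e : O}
    (he : algebraMap O B e = 0) (hker : ∀ o : O, algebraMap O B o = 0 → ∃ o', o = e * o') (p : P)
    (hp : (1 : B) ⊗ₜ[O] p = 0) : ∃ p', p = e • p' := by
  have hex : Function.Exact (LinearMap.mulLeft O e) (Algebra.linearMap O B) := fun o =>
    ⟨fun h => (hker o h).imp fun _ => Eq.symm, by rintro ⟨o', rfl⟩; simp [he]⟩
  obtain ⟨w, hw⟩ := (rTensor_exact P hex hπ ((1 : O) ⊗ₜ p)).1 (by simpa using hp)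
  obtain ⟨p', rfl⟩ := (TensorProduct.lid O P).symm.surjective w
  refine ⟨p', ?_⟩
  simpa using (congrArg (TensorProduct.lid O P) hw).symm

theorem exists_notMem_mul_eq_zero_of_mem_minimalPrimes {B : Type*} [CommRing B] [IsReduced B]
    {P : Ideal B} (hP : P ∈ minimalPrimes B) {x : B} (hx : x ∈ P) : ∃ t ∉ P, x * t = 0 := by
  have : P.IsPrime := hP.1.1
  have hnil : IsNilpotent (algebraMap B (Localization.AtPrime P) x) := by
    have hrad := IsLocalization.AtPrime.radical_map_of_mem_minimalPrimes
      (Localization.AtPrime P) P ⊥ hP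
    rw [Ideal.map_bot] at hrad
    have hmem := Ideal.mem_map_of_mem (algebraMap B (Localization.AtPrime P)) hx
    rwa [← hrad] at hmem
  obtain ⟨n, hn⟩ := hnil
  rw [← map_pow, IsLocalization.map_eq_zero_iff P.primeCompl] at hn
  obtain ⟨t, ht⟩ := hn
  refine ⟨t, t.2, IsNilpotent.eq_zero ⟨n + 1, ?_⟩⟩
  calc (x * t) ^ (n + 1) = x * t ^ n * (t * x ^ n) := by ring
    _ = 0 := by rw [ht, mul_zero]

variable {k O B : Type*} [Field k] [CommRing O] [CommRing B] [Algebra k O]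
variable [Algebra k B] [Algebra O B] [IsScalarTower k O B]

theorem finiteType_quotient_comap [Algebra.FiniteType k B]
    (hπ : Function.Surjective (algebraMap O B)) (p : Ideal B) :
    Algebra.FiniteType k (O ⧸ p.comap (algebraMap O B)) := by
  let φ : (O ⧸ p.comap (algebraMap O B)) →ₐ[k] B ⧸ p :=
    Ideal.quotientMapₐ p (IsScalarTower.toAlgHom k O B) le_rfl
  have hφ : Function.Bijective φ :=
    ⟨Ideal.quotientMap_injective, Ideal.quotientMap_surjective (H := le_rfl) hπ⟩
  exact Algebra.FiniteType.equiv inferInstance (AlgEquiv.ofBijective φ hφ).symm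

theorem jetKernelMap_injective [PerfectField k] [IsReduced B] [Algebra.FiniteType k B]
    {M : Type*} [AddCommGroup M] [Module O M] [Module.Projective O M]
    (hπ : Function.Surjective (algebraMap O B)) {e : O} (hee : e * e = 0)
    (he : algebraMap O B e = 0) (hker : ∀ o : O, algebraMap O B o = 0 → ∃ o', o = e * o')
    (hflat : ∀ o : O, e * o = 0 → ∃ o', o = e * o') :
    Function.Injective (jetKernelMap k M e he) := by
  rw [injective_iff_map_eq_zero]
  intro z hz
  obtain ⟨m, rfl⟩ := exists_eq_one_tmul hπ z
  rw [jetKernelMap_tmul] at hz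
  obtain ⟨p, hp⟩ : ∃ p : JetModule k O M, JetModule.mk (1 ⊗ₜ e) m = e • p := by
    exact exists_eq_smul_of_one_tmul_eq_zero hπ he hker _ hz
  suffices h : ∀ l : M →ₗ[O] O, ∃ y, l m = e * y by
    obtain ⟨m', rfl⟩ := exists_eq_smul_of_forall_dual m h
    exact one_tmul_smul_eq_zero he m'
  intro l
  refine hker _ ?_
  have hmin : algebraMap O B (l m) ∈ sInf (minimalPrimes B) := by
    rw [Submodule.mem_sInf]
    intro (P : Ideal B) hP
    have hprime : P.IsPrime := hP.1.1
    have := finiteType_quotient_comap (k := k) hπ P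
    obtain ⟨σ, hσ, hsq⟩ := exists_algHom_localization (k := k) hee (P.comap (algebraMap O B)) <| by
      intro x hx
      obtain ⟨b, hb, hxb⟩ := exists_notMem_mul_eq_zero_of_mem_minimalPrimes hP hx
      obtain ⟨s, rfl⟩ := hπ b
      exact ⟨s, hb, hker _ (by rw [mul_comm, map_mul, hxb])⟩
    let j := IsScalarTower.toAlgHom k O (Localization.AtPrime (P.comap (algebraMap O B)))
    have hl : jetModuleLift σ j hsq l (JetModule.mk (1 ⊗ₜ e) m) = 0 := by
      rw [hp, jetModuleLift_smul σ j hsq, hσ, zero_mul]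
    rw [jetModuleLift_mk σ j hsq] at hl
    simp only [Algebra.TensorProduct.productMap_apply_tmul, map_one, one_mul,
      j, IsScalarTower.coe_toAlgHom', ← map_mul] at hl
    obtain ⟨t, ht⟩ := (IsLocalization.map_eq_zero_iff (P.comap (algebraMap O B)).primeCompl _ _).1 hl
    obtain ⟨o', ho'⟩ := hflat (t * l m) (by rw [← ht]; ring)
    have h0 : algebraMap O B t * algebraMap O B (l m) ∈ P := by
      rw [← map_mul, ho', map_mul, he, zero_mul]
      exact P.zero_mem
    exact (hprime.mem_or_mem h0).resolve_left t.2
  rw [minimalPrimes, Ideal.sInf_minimalPrimes] at hmin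
  exact IsNilpotent.eq_zero hmin

end Injectivity

theorem exists_eq_eps_smul {k O : Type*} [Field k] [AddCommGroup O] [Module k[ε] O]
    [Module.Flat k[ε] O] (o : O) (h : (ε : k[ε]) • o = 0) : ∃ o', o = (ε : k[ε]) • o' := by
  obtain ⟨n, a, y, hay, ha⟩ := Module.Flat.isTrivialRelation_of_sum_smul_eq_zero
    (R := k[ε]) (M := O) (ι := Unit) (f := fun _ => ε) (x := fun _ => o) (by simpa using h)
  refine ⟨∑ j, algebraMap k k[ε] (TrivSqZeroExt.snd (a () j)) • y j, ?_⟩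
  rw [show o = _ from hay (), Finset.smul_sum]
  refine Finset.sum_congr rfl fun j _ => ?_
  rw [smul_smul]
  congr 1
  have hj : ε * a () j = 0 := by simpa using ha j
  have hfst := congrArg TrivSqZeroExt.snd hj
  rw [DualNumber.snd_mul] at hfst
  rw [TrivSqZeroExt.algebraMap_eq_inl]
  ext
  · simpa using hfst
  · simp

/-- let `B` be a reduced commutative `ℂ`-algebra of finite type, `Õ` a flat
`ℂ[ε]/(ε²)`-algebra with `Õ ⊗_{ℂ[ε]} ℂ ≅ B` (encoded by a surjection `π : Õ → B` whose
kernel is `ε·Õ`), `M̃` an invertible `Õ`-module, and `M = M̃ ⊗_Õ B`.  Then the natural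
restriction map `r : P¹_{Õ/ℂ}(M̃) ⊗_Õ B → P¹_{B/ℂ}(M)` is surjective and its kernel is
isomorphic to `M` as a `B`-module, so there is a short exact sequence of `B`-modules
`0 → M → P¹_{Õ/ℂ}(M̃) ⊗_Õ B → P¹_{B/ℂ}(M) → 0`. -/
theorem stmt10 (B : Type*) [CommRing B] [Algebra ℂ B] [IsReduced B]
    [Algebra.FiniteType ℂ B]
    (O : Type*) [CommRing O] [Algebra ℂ[ε] O] [Algebra ℂ O] [IsScalarTower ℂ ℂ[ε] O]
    [Module.Flat ℂ[ε] O]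
    (π : O →ₐ[ℂ] B) (hπ : Function.Surjective π)
    (hker : ∀ o : O, π o = 0 ↔ ∃ o' : O, o = (ε : ℂ[ε]) • o')
    (Mt : Type*) [AddCommGroup Mt] [Module O Mt] (hMt : IsInvertibleModule O Mt) :
    letI : Algebra O B := π.toRingHom.toAlgebra
    ∃ r : (B ⊗[O] JetModule ℂ O Mt) →ₗ[B] JetModule ℂ B (B ⊗[O] Mt),
      -- `r` is the natural restriction map
      (∀ (b : B) (x y : O) (m : Mt),
        r (b ⊗ₜ[O] JetModule.mk (x ⊗ₜ[ℂ] y) m) =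
          b • JetModule.mk ((π x : B) ⊗ₜ[ℂ] (π y : B)) ((1 : B) ⊗ₜ[O] m)) ∧
      -- `r` is surjective
      Function.Surjective r ∧
      -- and its kernel is isomorphic to `M = M̃ ⊗_Õ B` as a `B`-module
      ∃ f : (B ⊗[O] Mt) →ₗ[B] (B ⊗[O] JetModule ℂ O Mt),
        Function.Injective f ∧ Function.Exact f r := by
  let _ : Algebra O B := π.toRingHom.toAlgebra
  have : IsScalarTower ℂ O B := .of_algebraMap_eq fun c => (π.commutes c).symm
  have := hMt.2.1
  have hsmul : ∀ o : O, (ε : ℂ[ε]) • o = algebraMap ℂ[ε] O ε * o := fun o => Algebra.smul_def _ _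
  simp only [hsmul] at hker
  have hee : algebraMap ℂ[ε] O ε * algebraMap ℂ[ε] O ε = 0 := by
    rw [← map_mul, DualNumber.eps_mul_eps, map_zero]
  have he : algebraMap O B (algebraMap ℂ[ε] O ε) = 0 := (hker _).2 ⟨1, (mul_one _).symm⟩
  have hflat : ∀ o : O, algebraMap ℂ[ε] O ε * o = 0 → ∃ o', o = algebraMap ℂ[ε] O ε * o' := by
    intro o ho
    simpa only [hsmul] using exists_eq_eps_smul (k := ℂ) o ((hsmul o).trans ho)
  exact ⟨jetBaseChange ℂ O B Mt, fun b x y m => rfl, jetBaseChange_surjective hπ,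
    jetKernelMap ℂ Mt _ he, jetKernelMap_injective hπ hee he (fun o => (hker o).1) hflat,
    jetKernelMap_exact hπ he fun o => (hker o).1⟩
end
end
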